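/- As an identity of power series in q (valid for |q|<1): ∑_{n≥0} (M_ω(1,5,5n+4) − M_ω(4,5,5n+4)) q^n = 4·(q^5;q^5)_∞^4 / (q;q)_∞; equivalently, for every n ≥ 0, M_ω(1,5,5n+4) − M_ω(4,5,5n+4) = 4·c(n), where c(n) is the coefficient of q^n in (q^5;q^5)_∞^4 / (q;q)_∞. -/

import Mathlib

/-!
Common definitions: for a partition `π` of `n`,
`numParts` is the number of parts, `largestPart` the largest part,
`omegaOnes` the number of parts equal to 1, `rank` and `crank` the
Dyson rank and Andrews–Garvan crank.  `NT m j n` is the total number of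
parts over partitions of `n` with rank ≡ m (mod j), and `Mw m j n` is
the total number of ones over partitions of `n` with crank ≡ m (mod j).
`poch a q = (a; q)_∞ = ∏_{n ≥ 0} (1 - a qⁿ)`.
-/

namespace Beck

/-- number of parts of a partition -/
def numParts {n : ℕ} (π : n.Partition) : ℕ := Multiset.card π.parts

/-- largest part of a partition (0 for the empty partition) -/
def largestPart {n : ℕ} (π : n.Partition) : ℕ := π.parts.sup

/-- number of ones in a partition -/
def omegaOnes {n : ℕ} (π : n.Partition) : ℕ := π.parts.count 1

/-- number of parts strictly larger than the number of ones -/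
def muParts {n : ℕ} (π : n.Partition) : ℕ :=
  Multiset.card (π.parts.filter fun x => omegaOnes π < x)

/-- Dyson's rank: largest part minus number of parts -/
def rank {n : ℕ} (π : n.Partition) : ℤ :=
  (largestPart π : ℤ) - (numParts π : ℤ)

/-- the Andrews–Garvan crank -/
def crank {n : ℕ} (π : n.Partition) : ℤ :=
  if omegaOnes π = 0 then (largestPart π : ℤ)
  else (muParts π : ℤ) - (omegaOnes π : ℤ)

/-- `NT m j n`: total number of parts in partitions of `n` with rank ≡ m (mod j) -/
def NT (m j n : ℕ) : ℤ :=
  ∑ π : n.Partition,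
    if rank π % (j : ℤ) = (m : ℤ) % (j : ℤ) then (numParts π : ℤ) else 0

/-- `Mw m j n`: total number of ones in partitions of `n` with crank ≡ m (mod j) -/
def Mw (m j n : ℕ) : ℤ :=
  ∑ π : n.Partition,
    if crank π % (j : ℤ) = (m : ℤ) % (j : ℤ) then (omegaOnes π : ℤ) else 0

/-- `(a; q)_∞ = ∏_{n ≥ 0} (1 - a qⁿ)` -/
noncomputable def poch (a q : ℂ) : ℂ := ∏' n : ℕ, (1 - a * q ^ n)

section AuxiliaryResults
open PowerSeries Finset

section FormalProducts
variable {R : Type*} [CommRing R]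

/-- reduction of power series modulo `X ^ N` -/
noncomputable def modX (N : ℕ) : R⟦X⟧ →+* R⟦X⟧ ⧸ Ideal.span {(X : R⟦X⟧) ^ N} :=
  Ideal.Quotient.mk _

lemma modX_eq_iff {N : ℕ} {f g : R⟦X⟧} : modX N f = modX N g ↔ (X : R⟦X⟧) ^ N ∣ f - g := by
  rw [modX, Ideal.Quotient.eq, Ideal.mem_span_singleton]

lemma modX_eq_iff_coeff {N : ℕ} {f g : R⟦X⟧} :
    modX N f = modX N g ↔ ∀ n < N, coeff n f = coeff n g := by
  simp [modX_eq_iff, X_pow_dvd_iff, sub_eq_zero]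

lemma eq_of_modX_eq {f g : R⟦X⟧} (h : ∀ N, modX N f = modX N g) : f = g := by
  ext n
  exact modX_eq_iff_coeff.1 (h (n + 1)) n n.lt_succ_self

lemma modX_X_pow_of_le {N k : ℕ} (h : N ≤ k) : modX N ((X : R⟦X⟧) ^ k) = 0 := by
  rw [← map_zero (modX N), modX_eq_iff, sub_zero]
  exact pow_dvd_pow _ h

lemma modX_eq_zero_of_dvd {N k : ℕ} (h : N ≤ k) {f : R⟦X⟧} (hf : (X : R⟦X⟧) ^ k ∣ f) :
    modX N f = 0 := by
  obtain ⟨g, rfl⟩ := hf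
  rw [map_mul, modX_X_pow_of_le h, zero_mul]

/-- the formal infinite product `∏_{n ≥ 1} (1 - a Xⁿ)` -/
noncomputable def eulerProd (a : R⟦X⟧) : R⟦X⟧ :=
  mk fun n => coeff n (∏ i ∈ range n, (1 - a * X ^ (i + 1)))

lemma modX_prod_of_le (a : R⟦X⟧) {N M : ℕ} (h : N ≤ M) :
    modX (N + 1) (∏ i ∈ range M, (1 - a * X ^ (i + 1)))
      = modX (N + 1) (∏ i ∈ range N, (1 - a * X ^ (i + 1))) := by
  induction M, h using Nat.le_induction with
  | base => rfl
  | succ M h ih =>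
    rw [prod_range_succ, map_mul, ih, map_sub, map_mul, modX_X_pow_of_le (by omega)]
    simp

lemma modX_eulerProd (a : R⟦X⟧) {N M : ℕ} (h : N ≤ M + 1) :
    modX N (eulerProd a) = modX N (∏ i ∈ range M, (1 - a * X ^ (i + 1))) := by
  rw [modX_eq_iff_coeff]
  intro n hn
  rw [eulerProd, coeff_mk]
  exact (modX_eq_iff_coeff.1 (modX_prod_of_le a (show n ≤ M by omega)) n n.lt_succ_self).symm

/-- the formal sum of a family of power series `f k` divisible by `X ^ k` -/
noncomputable def serSum (f : ℕ → R⟦X⟧) : R⟦X⟧ :=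
  mk fun n => coeff n (∑ k ∈ range (n + 1), f k)

lemma modX_serSum {f : ℕ → R⟦X⟧} (hf : ∀ k, (X : R⟦X⟧) ^ k ∣ f k) {N M : ℕ} (h : N ≤ M) :
    modX N (serSum f) = modX N (∑ k ∈ range M, f k) := by
  rw [modX_eq_iff_coeff]
  intro n hn
  rw [serSum, coeff_mk]
  simp only [map_sum]
  refine sum_subset (range_subset_range.2 (by omega)) fun k _ hk => ?_
  exact X_pow_dvd_iff.1 (hf k) n (by simpa using hk)

lemma eulerProd_eq_mul (a : R⟦X⟧) : eulerProd a = (1 - a * X) * eulerProd (a * X) := by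
  refine eq_of_modX_eq fun N => ?_
  rw [modX_eulerProd a (M := N + 1) (by omega), map_mul, modX_eulerProd (a * X) (M := N) (by omega),
    prod_range_succ', ← map_mul, mul_comm]
  congr 2
  · ring
  · exact prod_congr rfl fun i _ => by ring

lemma eulerProd_eq_prod_mul (a : R⟦X⟧) (k : ℕ) :
    eulerProd a = (∏ i ∈ range k, (1 - a * X ^ (i + 1))) * eulerProd (a * X ^ k) := by
  induction k with
  | zero => simp
  | succ k ih =>
    rw [ih, eulerProd_eq_mul (a * X ^ k), prod_range_succ]
    ring_nf

lemma map_eulerProd {S : Type*} [CommRing S] (φ : R →+* S) (a : R) :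
    PowerSeries.map φ (eulerProd (C a)) = eulerProd (C (φ a)) := by
  ext n
  rw [coeff_map, eulerProd, eulerProd, coeff_mk, coeff_mk, ← coeff_map, map_prod]
  simp

lemma constantCoeff_eulerProd (a : R⟦X⟧) : constantCoeff (eulerProd a) = 1 := by
  rw [← coeff_zero_eq_constantCoeff_apply, eulerProd, coeff_mk]
  simp

lemma isUnit_eulerProd (a : R⟦X⟧) : IsUnit (eulerProd a) := by
  rw [isUnit_iff_constantCoeff, constantCoeff_eulerProd]
  exact isUnit_one

lemma modX_eulerProd_mul_X_pow (a : R⟦X⟧) (N : ℕ) : modX N (eulerProd (a * X ^ N)) = 1 := by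
  rw [modX_eulerProd _ (M := N) (by omega), map_prod]
  refine prod_eq_one fun i _ => ?_
  rw [map_sub, map_mul, map_mul, modX_X_pow_of_le le_rfl]
  simp

/-- the `n`-th triangular number -/
def tri (n : ℕ) : ℕ := n * (n + 1) / 2

lemma two_mul_tri (n : ℕ) : 2 * tri n = n * (n + 1) :=
  Nat.mul_div_cancel' (Nat.even_mul_succ_self n).two_dvd

lemma tri_succ (n : ℕ) : tri (n + 1) = tri n + n + 1 := by
  have := two_mul_tri n
  have := two_mul_tri (n + 1)
  nlinarith

lemma tri_strictMono : StrictMono tri :=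
  strictMono_nat_of_lt_succ fun n => by rw [tri_succ]; omega

/-- the power series `∑ₙ a n X ^ (n(n+1)/2)` -/
noncomputable def triSeries (a : ℕ → R) : R⟦X⟧ :=
  serSum fun n => C (a n) * X ^ tri n

lemma coeff_triSeries (a : ℕ → R) (m : ℕ) :
    coeff m (triSeries a) = ∑ k ∈ range (m + 1), if m = tri k then a k else 0 := by
  simp [triSeries, serSum, coeff_C_mul, coeff_X_pow]

lemma coeff_triSeries_tri (a : ℕ → R) (n : ℕ) : coeff (tri n) (triSeries a) = a n := by
  rw [coeff_triSeries, sum_eq_single n]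
  · simp
  · intro b _ hb
    rw [if_neg fun h => hb (tri_strictMono.injective h).symm]
  · intro h
    exact absurd (tri_strictMono.le_apply (x := n)) (by simp at h; omega)

lemma coeff_triSeries_of_ne (a : ℕ → R) {m : ℕ} (h : ∀ n, tri n ≠ m) :
    coeff m (triSeries a) = 0 := by
  rw [coeff_triSeries]
  exact sum_eq_zero fun k _ => if_neg fun e => h k e.symm

lemma modX_triSeries (a : ℕ → R) {N M : ℕ} (h : N ≤ M) :
    modX N (triSeries a) = modX N (∑ k ∈ range M, C (a k) * X ^ tri k) :=
  modX_serSum (fun _ => Dvd.dvd.mul_left (pow_dvd_pow _ tri_strictMono.le_apply) _) h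

end FormalProducts

section QBinomial
variable {R : Type*} [CommRing R]

/-- The **q-binomial theorem**, with the coefficients given by their recurrence. -/
theorem serSum_mul_eulerProd {c : ℕ → R⟦X⟧} {z : R⟦X⟧} (h0 : c 0 = 1)
    (hc : ∀ k, (1 - X ^ (k + 1)) * c (k + 1) = X * (1 - z * X ^ (k + 1)) * c k)
    (hX : ∀ k, (X : R⟦X⟧) ^ k ∣ c k) (t : R⟦X⟧) :
    serSum (fun k => t ^ k * c k) * eulerProd t = eulerProd (z * t * X) := by
  have hX' (t : R⟦X⟧) (k : ℕ) : (X : R⟦X⟧) ^ k ∣ t ^ k * c k := (hX k).mul_left _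
  have step (t : R⟦X⟧) : (1 - t * X) * serSum (fun k => t ^ k * c k)
      = (1 - t * z * X ^ 2) * serSum (fun k => (t * X) ^ k * c k) := by
    have key : serSum (fun k => t ^ k * c k) - serSum (fun k => (t * X) ^ k * c k)
        = t * X * (serSum (fun k => t ^ k * c k) - z * X * serSum (fun k => (t * X) ^ k * c k)) := by
      refine eq_of_modX_eq fun N => ?_
      rw [map_sub, modX_serSum (hX' t) (M := N + 1) (by omega),
        modX_serSum (hX' (t * X)) (M := N + 1) (by omega), map_mul _ (t * X), map_sub,
        map_mul _ (z * X), modX_serSum (hX' t) le_rfl, modX_serSum (hX' (t * X)) le_rfl,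
        ← map_sub, ← map_mul, ← map_sub, ← map_mul]
      congr 1
      rw [← sum_sub_distrib, sum_range_succ', mul_sum, ← sum_sub_distrib, mul_sum]
      simp only [pow_zero, sub_self, add_zero]
      refine sum_congr rfl fun k _ => ?_
      linear_combination t ^ (k + 1) * hc k
    linear_combination key
  have iter (N : ℕ) : serSum (fun k => t ^ k * c k) * eulerProd t
      = (∏ j ∈ range N, (1 - z * t * X * X ^ (j + 1))) *
        (serSum (fun k => (t * X ^ N) ^ k * c k) * eulerProd (t * X ^ N)) := by
    induction N with
    | zero => simp
    | succ N ih =>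
      rw [ih, prod_range_succ, eulerProd_eq_mul (t * X ^ N)]
      have := step (t * X ^ N)
      rw [mul_assoc t, ← pow_succ] at this ⊢
      linear_combination (∏ j ∈ range N, (1 - z * t * X * X ^ (j + 1))) *
        eulerProd (t * X ^ (N + 1)) * this
  refine eq_of_modX_eq fun N => ?_
  rw [iter N, map_mul, map_mul, modX_eulerProd_mul_X_pow, modX_eulerProd _ (M := N) (by omega),
    modX_serSum (hX' _) (M := N + 1) (by omega), sum_range_succ', map_add, map_sum,
    sum_eq_zero fun k _ => ?_]
  · simp [h0]
  · refine modX_eq_zero_of_dvd le_rfl (Dvd.dvd.mul_right ?_ _)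
    exact dvd_pow (dvd_mul_left _ _) (by omega)

end QBinomial

section TripleProduct
variable (R : Type*) [CommRing R]

/-- the q-factorial `(1 - X) ⋯ (1 - X ^ k)` -/
noncomputable def qFac (k : ℕ) : R⟦X⟧ := ∏ i ∈ range k, (1 - X ^ (i + 1))

lemma qFac_succ (k : ℕ) : qFac R (k + 1) = qFac R k * (1 - X ^ (k + 1)) := prod_range_succ _ _

lemma modX_qFac {N k : ℕ} (h : N ≤ k + 1) : modX N (qFac R k) = modX N (eulerProd 1) := by
  rw [modX_eulerProd 1 h, qFac]
  simp

/-- the Gaussian binomial coefficient `[2 * N + 1, N - n]` -/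
noncomputable def gaussOdd : ℕ → ℕ → R⟦X⟧
  | 0, n => if n = 0 then 1 else 0
  | N + 1, 0 => (1 + X ^ (2 * N + 2) + X ^ (N + 1)) * gaussOdd N 0 + X ^ (N + 2) * gaussOdd N 1
  | N + 1, n + 1 => (1 + X ^ (2 * N + 2)) * gaussOdd N (n + 1) + X ^ (N - n) * gaussOdd N n
      + X ^ (N + n + 3) * gaussOdd N (n + 2)

lemma gaussOdd_of_lt {N n : ℕ} (h : N < n) : gaussOdd R N n = 0 := by
  induction N generalizing n with
  | zero => simp [gaussOdd, h.ne']
  | succ N ih =>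
    obtain ⟨n, rfl⟩ : ∃ k, n = k + 1 := ⟨n - 1, by omega⟩
    simp [gaussOdd, ih (show N < n by omega), ih (show N < n + 1 by omega),
      ih (show N < n + 2 by omega)]

lemma gaussOdd_mul_qFac (n m : ℕ) :
    gaussOdd R (n + m) n * (qFac R m * qFac R (2 * n + m + 1)) = qFac R (2 * (n + m) + 1) := by
  suffices h : ∀ N n m, n + m = N →
      gaussOdd R N n * (qFac R m * qFac R (N + n + 1)) = qFac R (2 * N + 1) by
    convert h (n + m) n m rfl using 4
    ring
  intro N
  induction N with
  | zero =>
    intro n m h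
    obtain ⟨rfl, rfl⟩ : n = 0 ∧ m = 0 := by omega
    simp [gaussOdd, qFac]
  | succ N ih =>
    have ih' (n m : ℕ) (h : n + m = N) : gaussOdd R N (n + 1) * (qFac R m * qFac R (N + n + 2))
        = (1 - X ^ m) * qFac R (2 * N + 1) := by
      rcases m with _ | m
      · simp [gaussOdd_of_lt R (show N < n + 1 by omega)]
      · rw [← ih (n + 1) m (by omega), qFac_succ R m, ← add_assoc N]
        ring
    intro n m h
    rw [show 2 * (N + 1) + 1 = 2 * N + 1 + 1 + 1 by ring, qFac_succ R (2 * N + 1 + 1)]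
    rcases n with _ | n
    · obtain rfl : m = N + 1 := by omega
      have h0 := ih 0 N (by omega)
      have h1 := ih' 0 N (by omega)
      simp only [add_zero, gaussOdd, qFac_succ] at h0 h1 ⊢
      linear_combination (1 + X ^ (2 * N + 2) + X ^ (N + 1)) * (1 - X ^ (N + 1)) *
        (1 - X ^ (N + 2)) * h0 + X ^ (N + 2) * (1 - X ^ (N + 1)) * h1
    · have h0 := ih n m (by omega)
      have h1 := ih' n m (by omega)
      have h2 : gaussOdd R N (n + 2) * (qFac R m * qFac R (N + n + 3))
          = (1 - X ^ m) * (1 - X ^ (m - 1)) * qFac R (2 * N + 1) := by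
        rcases m with _ | m
        · simp [gaussOdd_of_lt R (show N < n + 2 by omega)]
        · have := ih' (n + 1) m (by omega)
          rw [qFac_succ R m, show m + 1 - 1 = m by omega]
          rw [← add_assoc N] at this
          linear_combination (1 - X ^ (m + 1)) * this
      rw [show N + 1 + (n + 1) + 1 = N + n + 1 + 1 + 1 by omega, qFac_succ R (N + n + 1 + 1),
        qFac_succ R (N + n + 1)]
      rw [show N + n + 3 = N + n + 1 + 1 + 1 by omega, qFac_succ R (N + n + 1 + 1),
        qFac_succ R (N + n + 1)] at h2
      rw [show N + n + 2 = N + n + 1 + 1 by omega, qFac_succ R (N + n + 1)] at h1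
      rw [qFac_succ R (2 * N + 1)]
      rcases m with _ | m
      · obtain rfl : n = N := by omega
        simp only [gaussOdd, gaussOdd_of_lt R (show n < n + 1 by omega),
          gaussOdd_of_lt R (show n < n + 2 by omega), Nat.sub_self]
        linear_combination (1 - X ^ (2 * n + 2)) * (1 - X ^ (2 * n + 3)) * h0
      · obtain rfl : N = n + (m + 1) := by omega
        simp only [gaussOdd, Nat.add_sub_cancel_left, Nat.add_sub_cancel] at h0 h1 h2 ⊢
        linear_combination (1 + X ^ (2 * (n + (m + 1)) + 2)) *
          (1 - X ^ (n + (m + 1) + n + 3)) * h1 + X ^ (m + 1) * (1 - X ^ (n + (m + 1) + n + 2)) *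
          (1 - X ^ (n + (m + 1) + n + 3)) * h0 + X ^ (n + (m + 1) + n + 3) * h2

variable {R}

/-- the Laurent sum `u⁻ⁿ + ⋯ + uⁿ`, for mutually inverse `u` and `v` -/
def symSum (u v : R) (n : ℕ) : R := 1 + ∑ i ∈ range n, (u ^ (i + 1) + v ^ (i + 1))

lemma symSum_succ (u v : R) (n : ℕ) :
    symSum u v (n + 1) = symSum u v n + u ^ (n + 1) + v ^ (n + 1) := by
  rw [symSum, sum_range_succ, symSum]
  ring

lemma add_mul_symSum_zero (u v : R) : (u + v) * symSum u v 0 = symSum u v 1 - symSum u v 0 := by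
  simp [symSum]

lemma add_mul_symSum_succ {u v : R} (h : u * v = 1) (n : ℕ) :
    (u + v) * symSum u v (n + 1) = symSum u v (n + 2) + symSum u v n := by
  induction n with
  | zero => simp only [symSum, sum_range_succ, range_zero, sum_empty]; linear_combination 2 * h
  | succ n ih =>
    have h0 := symSum_succ u v n
    have h1 := symSum_succ u v (n + 1)
    have h2 := symSum_succ u v (n + 2)
    simp only [add_assoc, Nat.reduceAdd] at h1 h2 ih ⊢
    linear_combination ih + (u ^ (n + 1) + v ^ (n + 1)) * h + (u + v) * h1 - h2 - h0

/-- the finite form of the Jacobi triple product identity -/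
lemma prod_eq_sum_gaussOdd {u v : R} (h : u * v = 1) (N : ℕ) :
    (∏ i ∈ range N, (1 - C u * X ^ (i + 1))) * (∏ i ∈ range N, (1 - C v * X ^ (i + 1)))
      = ∑ n ∈ range (N + 1), C ((-1) ^ n * symSum u v n) * X ^ tri n * gaussOdd R N n := by
  induction N with
  | zero => simp [gaussOdd, symSum, tri]
  | succ N ih =>
    set g : ℕ → R⟦X⟧ := fun n => C ((-1) ^ n * symSum u v n) * X ^ tri n with hg
    have h0 : g 0 * (C u + C v) * X ^ (N + 1) = - g 1 * X ^ N - g 0 * X ^ (N + 1) := by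
      have := congrArg (C (R := R)) (add_mul_symSum_zero u v)
      simp only [hg, map_mul, map_sub, map_add, tri_succ, map_neg, map_pow, map_one] at this ⊢
      linear_combination X ^ tri 0 * X ^ (N + 1) * this
    have h1 (n : ℕ) (hn : n + 1 ≤ N) : g (n + 1) * (C u + C v) * X ^ (N + 1)
        = - g (n + 2) * X ^ (N - (n + 1)) - g n * X ^ (N + n + 2) := by
      have := congrArg (C (R := R)) (add_mul_symSum_succ h n)
      obtain ⟨m, rfl⟩ := Nat.exists_eq_add_of_le hn
      simp only [hg, map_mul, map_add, tri_succ, map_neg, map_pow, map_one,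
        Nat.add_sub_cancel_left] at this ⊢
      linear_combination (-1) ^ (n + 1) * X ^ (tri n + n + 1) * X ^ (n + 1 + m + 1) * this
    have h2 : (∑ n ∈ range (N + 1), g n * gaussOdd R N n) * (C u + C v) * X ^ (N + 1)
        = - (∑ n ∈ range (N + 1), g (n + 1) * X ^ (N - n) * gaussOdd R N n)
          - g 0 * X ^ (N + 1) * gaussOdd R N 0
          - ∑ n ∈ range N, g n * X ^ (N + n + 2) * gaussOdd R N (n + 1) := by
      have h3 : (∑ n ∈ range N, g (n + 1) * gaussOdd R N (n + 1)) * (C u + C v) * X ^ (N + 1)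
          = - (∑ n ∈ range N, g (n + 2) * X ^ (N - (n + 1)) * gaussOdd R N (n + 1))
          - ∑ n ∈ range N, g n * X ^ (N + n + 2) * gaussOdd R N (n + 1) := by
        rw [sum_mul, sum_mul, ← sum_neg_distrib, ← sum_sub_distrib]
        refine sum_congr rfl fun n hn => ?_
        linear_combination gaussOdd R N (n + 1) * h1 n (by simpa using hn)
      rw [sum_range_succ', sum_range_succ', Nat.sub_zero]
      linear_combination h3 + gaussOdd R N 0 * h0
    have h4 : ∑ n ∈ range (N + 1), g (n + 1) * X ^ (N + n + 3) * gaussOdd R N (n + 2)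
        + g 0 * X ^ (N + 2) * gaussOdd R N 1
        = ∑ n ∈ range N, g n * X ^ (N + n + 2) * gaussOdd R N (n + 1) := by
      have := sum_range_succ' (fun n => g n * X ^ (N + n + 2) * gaussOdd R N (n + 1)) (N + 1)
      rw [sum_range_succ, sum_range_succ, gaussOdd_of_lt R (show N < N + 1 by omega),
        gaussOdd_of_lt R (show N < N + 1 + 1 by omega), mul_zero, mul_zero, add_zero,
        add_zero] at this
      rw [this]
      congr 1
    have h5 : ∑ n ∈ range (N + 1), g (n + 1) * gaussOdd R N (n + 1) + g 0 * gaussOdd R N 0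
        = ∑ n ∈ range (N + 1), g n * gaussOdd R N n := by
      rw [← sum_range_succ' (fun n => g n * gaussOdd R N n), sum_range_succ,
        gaussOdd_of_lt R (show N < N + 1 by omega), mul_zero, add_zero]
    have h6 : ∑ n ∈ range (N + 1), g (n + 1) * gaussOdd R (N + 1) (n + 1)
        = (1 + X ^ (2 * N + 2)) * (∑ n ∈ range (N + 1), g (n + 1) * gaussOdd R N (n + 1))
          + ∑ n ∈ range (N + 1), g (n + 1) * X ^ (N - n) * gaussOdd R N n
          + ∑ n ∈ range (N + 1), g (n + 1) * X ^ (N + n + 3) * gaussOdd R N (n + 2) := by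
      rw [mul_sum, ← sum_add_distrib, ← sum_add_distrib]
      refine sum_congr rfl fun n _ => ?_
      rw [gaussOdd]
      ring
    have hC : C u * C v = (1 : R⟦X⟧) := by rw [← map_mul, h, map_one]
    rw [prod_range_succ, prod_range_succ, sum_range_succ', h6, gaussOdd]
    linear_combination (1 - C u * X ^ (N + 1)) * (1 - C v * X ^ (N + 1)) * ih - h2 - h4
      - (1 + X ^ (2 * N + 2)) * h5 + (∑ n ∈ range (N + 1), g n * gaussOdd R N n) *
        X ^ (2 * N + 2) * hC

lemma modX_eulerProd_mul_gaussOdd {N n : ℕ} (h : n < N) :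
    modX N (eulerProd 1 * gaussOdd R (2 * N) n) = 1 := by
  have := congrArg (modX N) (gaussOdd_mul_qFac R n (2 * N - n))
  rw [Nat.add_sub_cancel' (by omega), map_mul, map_mul, modX_qFac R (by omega),
    modX_qFac R (by omega), modX_qFac R (by omega)] at this
  have hu : IsUnit (modX N (eulerProd (1 : R⟦X⟧))) := (isUnit_eulerProd _).map _
  rw [map_mul]
  refine hu.mul_left_cancel ?_
  linear_combination this

/-- The **Jacobi triple product identity**. -/
theorem eulerProd_triple {u v : R} (h : u * v = 1) :
    eulerProd 1 * (eulerProd (C u) * eulerProd (C v))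
      = triSeries fun n => (-1) ^ n * symSum u v n := by
  refine eq_of_modX_eq fun N => ?_
  rw [map_mul, map_mul, modX_eulerProd (C u) (M := 2 * N) (by omega),
    modX_eulerProd (C v) (M := 2 * N) (by omega), ← map_mul (modX N) (∏ _ ∈ _, _),
    prod_eq_sum_gaussOdd h, modX_triSeries _ (M := 2 * N + 1) (by omega), map_sum, map_sum,
    mul_sum]
  refine sum_congr rfl fun n _ => ?_
  by_cases hn : n < N
  · rw [map_mul, mul_left_comm, ← map_mul, modX_eulerProd_mul_gaussOdd hn, mul_one]
  · rw [modX_eq_zero_of_dvd (k := tri n) (f := C _ * X ^ tri n)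
      ((not_lt.1 hn).trans tri_strictMono.le_apply) (dvd_mul_left _ _),
      map_mul, modX_eq_zero_of_dvd (k := tri n) (f := C _ * X ^ tri n)
      ((not_lt.1 hn).trans tri_strictMono.le_apply) (dvd_mul_left _ _)]
    simp

/-- **Jacobi's identity** for the cube of the Euler product. -/
theorem eulerProd_one_pow_three :
    eulerProd (1 : R⟦X⟧) ^ 3 = triSeries fun n => (-1) ^ n * (2 * (n : R) + 1) := by
  have := eulerProd_triple (one_mul (1 : R))
  rw [map_one] at this
  rw [pow_three, this]
  congr 1
  ext n
  simp [symSum]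
  ring

end TripleProduct

section CrankGeneratingFunction
variable {R : Type*} [CommRing R]

/-- the weight of a partition: `w` for the multiplicity of `1`, and `z` for every part
larger than `k` -/
def crankWeight (w : ℕ → R) (z : R) (k i c : ℕ) : R :=
  if i = 1 then w c else if k < i then z ^ c else 1

lemma prod_crankWeight {k : ℕ} (hk : 1 ≤ k) (w : ℕ → R) (z : R) {n : ℕ} (π : n.Partition) :
    π.parts.toFinsupp.prod (crankWeight w z k)
      = (if omegaOnes π = 0 then 1 else w (omegaOnes π))
        * z ^ Multiset.card (π.parts.filter fun x => k < x) := by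
  have h (i : ℕ) (c : ℕ) : crankWeight w z k i c
      = (if i = 1 then w c else 1) * z ^ (if k < i then c else 0) := by
    unfold crankWeight
    split_ifs <;> first | omega | simp
  simp only [Finsupp.prod, h, prod_mul_distrib, Multiset.toFinsupp_support,
    Multiset.toFinsupp_apply, prod_pow_eq_pow_sum]
  congr 2
  · simp [prod_ite_eq', omegaOnes, Multiset.count_eq_zero]
  · rw [← sum_filter, ← Multiset.toFinset_filter,
      ← Multiset.toFinset_sum_count_eq (π.parts.filter fun x => k < x)]
    refine sum_congr rfl fun i hi => ?_
    rw [Multiset.count_filter_of_pos (by simpa using (Multiset.mem_filter.1 (by simpa using hi)).2)]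

open scoped PowerSeries.WithPiTopology in
lemma genFun_crankWeight_mul [TopologicalSpace R] [DiscreteTopology R] {k : ℕ} (hk : 1 ≤ k)
    (w : ℕ → R) (z : R) :
    Nat.Partition.genFun (crankWeight w z k)
        * ((∏ i ∈ range k, (1 - X ^ (i + 1))) * eulerProd (C z * X ^ k))
      = (1 + ∑' j : ℕ, w (j + 1) • (X : R⟦X⟧) ^ (j + 1)) * (1 - X) := by
  set P : ℕ → R⟦X⟧ := fun i =>
    1 + ∑' j : ℕ, crankWeight w z k (i + 1) (j + 1) • (X : R⟦X⟧) ^ ((i + 1) * (j + 1)) with hP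
  set a : ℕ → R⟦X⟧ := fun i => 1 - C (if k < i + 1 then z else 1) * X ^ (i + 1) with ha
  have hPa (i : ℕ) : P (i + 1) * a (i + 1) = 1 := by
    have h1 : P (i + 1)
        = ∑' j : ℕ, (C (if k < i + 1 + 1 then z else 1) * (X : R⟦X⟧) ^ (i + 1 + 1)) ^ j := by
      have hs : Summable fun j : ℕ =>
          (C (if k < i + 1 + 1 then z else 1) * (X : R⟦X⟧) ^ (i + 1 + 1)) ^ j :=
        WithPiTopology.summable_pow_of_constantCoeff_eq_zero (by simp)
      rw [hs.tsum_eq_zero_add, pow_zero, hP]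
      refine congrArg (1 + ·) (tsum_congr fun j => ?_)
      rw [mul_pow, ← map_pow, ← pow_mul, smul_eq_C_mul, crankWeight, if_neg (by omega)]
      split_ifs <;> simp
    rw [h1, ha]
    exact WithPiTopology.tsum_pow_mul_one_sub_of_constantCoeff_eq_zero (by simp)
  have hP0 : P 0 * a 0 = (1 + ∑' j : ℕ, w (j + 1) • (X : R⟦X⟧) ^ (j + 1)) * (1 - X) := by
    simp [hP, ha, crankWeight, show k ≠ 0 by omega]
  have hprod (M : ℕ) : (∏ i ∈ range (M + 1), P i) * ∏ i ∈ range (M + 1), a i = P 0 * a 0 := by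
    rw [← prod_mul_distrib, prod_range_succ']
    simp [hPa]
  have hlim (N : ℕ) : ∀ᶠ M in Filter.atTop,
      modX N (∏ i ∈ range M, P i) = modX N (Nat.Partition.genFun (crankWeight w z k)) := by
    have := (Nat.Partition.hasProd_genFun (crankWeight w z k)).tendsto_prod_nat
    rw [WithPiTopology.tendsto_iff_coeff_tendsto] at this
    simp only [nhds_discrete, Filter.tendsto_pure] at this
    simp only [modX_eq_iff_coeff]
    have h2 := (Filter.eventually_all_finset (range N)).2 fun n _ => this n
    filter_upwards [h2] with M hM n hn
    exact hM n (by simpa using hn)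
  refine eq_of_modX_eq fun N => ?_
  obtain ⟨M, hM⟩ := Filter.eventually_atTop.1 (hlim N)
  have hM' := hM (k + (M + N) + 1) (by omega)
  rw [← hP0, ← hprod (k + (M + N)), map_mul, map_mul, ← hM', add_assoc, prod_range_add a,
    map_mul, map_mul, modX_eulerProd (C z * X ^ k) (M := M + N + 1) (by omega)]
  congr 3
  · refine prod_congr rfl fun i hi => ?_
    simp only [mem_range] at hi
    simp [ha, show ¬ k ≤ i by omega]
  · refine prod_congr rfl fun i hi => ?_
    simp [ha, pow_add, mul_assoc]

/-- the generating function of partitions with `k` ones, with `z` marking the parts larger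
than `k` -/
def crankSeries (z : R) (k : ℕ) : R⟦X⟧ :=
  mk fun n => ∑ π : n.Partition, if omegaOnes π = k then z ^ muParts π else 0

theorem crankSeries_mul {k : ℕ} (hk : 1 ≤ k) (z : R) :
    crankSeries z k * ((∏ i ∈ range k, (1 - X ^ (i + 1))) * eulerProd (C z * X ^ k))
      = X ^ k * (1 - X) := by
  let _ : TopologicalSpace R := ⊥
  have : DiscreteTopology R := ⟨rfl⟩
  have h1 := genFun_crankWeight_mul hk (fun c => if c = k then 1 else 0) z
  have h2 := genFun_crankWeight_mul hk (fun _ => 0) z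
  have h3 : crankSeries z k
      = Nat.Partition.genFun (crankWeight (fun c => if c = k then 1 else 0) z k)
      - Nat.Partition.genFun (crankWeight (fun _ => 0) z k) := by
    ext n
    rw [map_sub, Nat.Partition.coeff_genFun, Nat.Partition.coeff_genFun, crankSeries, coeff_mk,
      ← sum_sub_distrib]
    refine sum_congr rfl fun π _ => ?_
    rw [prod_crankWeight hk, prod_crankWeight hk, muParts]
    by_cases h0 : omegaOnes π = 0
    · simp [h0, show ¬ 0 = k by omega]
    · by_cases h : omegaOnes π = k
      · simp [h, show k ≠ 0 by omega]
      · simp [h, h0]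
  open scoped PowerSeries.WithPiTopology in
  have h4 : ∑' j : ℕ, (if j + 1 = k then (1 : R) else 0) • (X : R⟦X⟧) ^ (j + 1) = X ^ k := by
    rw [tsum_eq_single (k - 1)]
    · rw [Nat.sub_add_cancel hk]; simp
    · intro j hj
      rw [if_neg (by omega), zero_smul]
  rw [h3, sub_mul, h1, h2, h4]
  simp
  ring
end CrankGeneratingFunction

section FormalSums
variable {R : Type*} [CommRing R]

lemma mul_serSum {f : ℕ → R⟦X⟧} (hf : ∀ k, (X : R⟦X⟧) ^ k ∣ f k) (g : R⟦X⟧) :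
    g * serSum f = serSum fun k => g * f k := by
  refine eq_of_modX_eq fun N => ?_
  rw [map_mul, modX_serSum hf le_rfl, modX_serSum (fun k => (hf k).mul_left g) le_rfl, ← map_mul,
    mul_sum]

end FormalSums

section CrankMoment
variable {R : Type*} [CommRing R]

lemma isUnit_qFac (k : ℕ) : IsUnit (qFac R k) := by
  rw [isUnit_iff_constantCoeff, qFac, map_prod]
  simp

/-- the power series `Xᵏ (zX; X)_k / (X; X)_k` -/
noncomputable def qBinomTerm (z : R) (k : ℕ) : R⟦X⟧ :=
  X ^ k * (∏ i ∈ range k, (1 - C z * X ^ (i + 1))) * Ring.inverse (qFac R k)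

lemma qFac_mul_qBinomTerm (z : R) (k : ℕ) :
    qFac R k * qBinomTerm z k = X ^ k * ∏ i ∈ range k, (1 - C z * X ^ (i + 1)) := by
  rw [qBinomTerm, mul_left_comm, Ring.mul_inverse_cancel _ (isUnit_qFac k), mul_one]

lemma X_pow_dvd_qBinomTerm (z : R) (k : ℕ) : X ^ k ∣ qBinomTerm z k := by
  rw [qBinomTerm, mul_assoc]
  exact dvd_mul_right _ _

lemma qBinomTerm_succ (z : R) (k : ℕ) :
    (1 - X ^ (k + 1)) * qBinomTerm z (k + 1)
      = X * (1 - C z * X ^ (k + 1)) * qBinomTerm z k := by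
  apply (isUnit_qFac k).mul_left_cancel
  have h1 := qFac_mul_qBinomTerm z (k + 1)
  rw [qFac_succ, prod_range_succ] at h1
  linear_combination h1 - X * (1 - C z * X ^ (k + 1)) * qFac_mul_qBinomTerm z k

lemma map_qBinomTerm {S : Type*} [CommRing S] (φ : R →+* S) (z : R) (k : ℕ) :
    PowerSeries.map φ (qBinomTerm z k) = qBinomTerm (φ z) k := by
  apply (isUnit_qFac k).mul_left_cancel
  have h : qFac S k = PowerSeries.map φ (qFac R k) := by simp [qFac, map_prod]
  rw [qFac_mul_qBinomTerm, h, ← map_mul, qFac_mul_qBinomTerm]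
  simp [map_prod]

lemma eulerProd_mul_crankSeries {k : ℕ} (hk : 1 ≤ k) (z : R) :
    eulerProd (C z) * crankSeries z k = (1 - X) * qBinomTerm z k := by
  apply (isUnit_qFac k).mul_left_cancel
  have h1 := crankSeries_mul hk z
  rw [← qFac] at h1
  rw [eulerProd_eq_prod_mul (C z) k]
  linear_combination (∏ i ∈ range k, (1 - C z * X ^ (i + 1))) * h1
    - (1 - X) * qFac_mul_qBinomTerm z k

lemma omegaOnes_le {n : ℕ} (π : n.Partition) : omegaOnes π ≤ n := by
  have h1 : omegaOnes π ≤ Multiset.card π.parts := Multiset.count_le_card _ _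
  have h2 := Multiset.card_nsmul_le_sum (s := π.parts) (a := 1) fun x hx => π.parts_pos hx
  rw [π.parts_sum] at h2
  simp at h2
  omega

/-- the generating function of partitions weighted by `ω`, with `z` marking `μ` and
`y` marking `ω` -/
def crankMoment (z y : R) : R⟦X⟧ :=
  mk fun n => ∑ π : n.Partition, (omegaOnes π : R) * y ^ omegaOnes π * z ^ muParts π

lemma crankMoment_eq_serSum (z y : R) :
    crankMoment z y = serSum fun k => C ((k : R) * y ^ k) * crankSeries z k := by
  ext n
  simp only [crankMoment, serSum, coeff_mk, map_sum, coeff_C_mul, crankSeries, mul_sum]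
  rw [sum_comm]
  refine sum_congr rfl fun π _ => ?_
  rw [sum_eq_single (omegaOnes π)]
  · simp
  · intro k _ hk
    simp [hk.symm]
  · intro h
    have := omegaOnes_le π
    simp at h
    omega

lemma eulerProd_mul_crankMoment (z y : R) :
    eulerProd (C z) * crankMoment z y
      = (1 - X) * serSum fun k => C ((k : R) * y ^ k) * qBinomTerm z k := by
  have h (k : ℕ) : eulerProd (C z) * (C ((k : R) * y ^ k) * crankSeries z k)
      = (1 - X) * (C ((k : R) * y ^ k) * qBinomTerm z k) := by
    rcases Nat.eq_zero_or_pos k with rfl | hk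
    · simp
    · linear_combination C ((k : R) * y ^ k) * eulerProd_mul_crankSeries hk z
  rw [crankMoment_eq_serSum, mul_serSum, mul_serSum]
  · simp only [h]
  · exact fun k => (X_pow_dvd_qBinomTerm z k).mul_left _
  · intro k
    rw [← (isUnit_eulerProd (C z)).dvd_mul_left, h]
    exact ((X_pow_dvd_qBinomTerm z k).mul_left _).mul_left _

end CrankMoment

section DualNumbers
open DualNumber
variable {R : Type*} [CommRing R]

/-- the value at `ε = 0` of a power series with dual number coefficients -/
noncomputable def epsZero : R[ε]⟦X⟧ →+* R⟦X⟧ :=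
  PowerSeries.map (TrivSqZeroExt.fstHom R R R).toRingHom

/-- the derivative in `ε` of a power series with dual number coefficients -/
noncomputable def epsDeriv (f : R[ε]⟦X⟧) : R⟦X⟧ := mk fun n => (coeff n f).snd

lemma coeff_epsZero (f : R[ε]⟦X⟧) (n : ℕ) : coeff n (epsZero f) = (coeff n f).fst := rfl

lemma coeff_epsDeriv (f : R[ε]⟦X⟧) (n : ℕ) : coeff n (epsDeriv f) = (coeff n f).snd :=
  coeff_mk _ _

lemma epsDeriv_mul (f g : R[ε]⟦X⟧) :
    epsDeriv (f * g) = epsZero f * epsDeriv g + epsDeriv f * epsZero g := by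
  ext n
  simp only [coeff_epsDeriv, coeff_mul, map_add, coeff_epsZero, TrivSqZeroExt.snd_sum,
    ← sum_add_distrib]
  refine sum_congr rfl fun i _ => ?_
  rw [TrivSqZeroExt.snd_mul]
  simp [mul_comm]

lemma epsDeriv_sub (f g : R[ε]⟦X⟧) : epsDeriv (f - g) = epsDeriv f - epsDeriv g := by
  ext n; simp [coeff_epsDeriv]

lemma epsDeriv_C (a : R[ε]) : epsDeriv (C a) = C a.snd := by
  ext n; simp only [coeff_epsDeriv, coeff_C]; split_ifs <;> simp

lemma epsDeriv_map (f : R⟦X⟧) :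
    epsDeriv (PowerSeries.map (TrivSqZeroExt.inlHom R R) f) = 0 := by
  ext n; simp [coeff_epsDeriv]

lemma epsZero_map (f : R⟦X⟧) :
    epsZero (PowerSeries.map (TrivSqZeroExt.inlHom R R) f) = f := by
  ext n; simp [coeff_epsZero]

lemma epsDeriv_X_pow (n : ℕ) : epsDeriv (X ^ n : R[ε]⟦X⟧) = 0 := by
  have := epsDeriv_map (X ^ n : R⟦X⟧)
  simpa using this

lemma epsZero_C (a : R[ε]) : epsZero (C a) = C a.fst := by
  ext n; simp only [coeff_epsZero, coeff_C]; split_ifs <;> simp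

lemma epsZero_X : epsZero (X : R[ε]⟦X⟧) = X := by simp [epsZero]

lemma epsZero_eulerProd (a : R[ε]) : epsZero (eulerProd (C a)) = eulerProd (C a.fst) :=
  map_eulerProd _ a

lemma epsDeriv_serSum (f : ℕ → R[ε]⟦X⟧) :
    epsDeriv (serSum f) = serSum fun k => epsDeriv (f k) := by
  ext n
  simp [coeff_epsDeriv, serSum, TrivSqZeroExt.snd_sum]

lemma epsDeriv_eulerProd_inl (a : R) :
    epsDeriv (eulerProd (C (TrivSqZeroExt.inl a : R[ε]))) = 0 := by
  have := epsDeriv_map (eulerProd (C a))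
  rwa [map_eulerProd] at this

end DualNumbers

section DualNumberIdentity
open DualNumber
variable {R : Type*} [CommRing R]

/-- the derivative `D ∏ (1 - aXⁿ)` where `D = a d/da` -/
noncomputable def eulerDeriv (a : R) : R⟦X⟧ :=
  epsDeriv (eulerProd (C (TrivSqZeroExt.inl a + TrivSqZeroExt.inr a : R[ε])))

lemma epsDeriv_eulerProd_sub (a : R) :
    epsDeriv (eulerProd (C (TrivSqZeroExt.inl a - TrivSqZeroExt.inr a : R[ε])))
      = -eulerDeriv a := by
  have h : eulerProd (C (TrivSqZeroExt.inl a + TrivSqZeroExt.inr a : R[ε]))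
      * eulerProd (C (TrivSqZeroExt.inl a - TrivSqZeroExt.inr a : R[ε]))
      = eulerProd (C (TrivSqZeroExt.inl a : R[ε])) * eulerProd (C (TrivSqZeroExt.inl a : R[ε])) := by
    refine eq_of_modX_eq fun N => ?_
    simp only [map_mul, modX_eulerProd _ (le_add_right (le_refl N) : N ≤ N + 1)]
    simp only [← map_mul, ← prod_mul_distrib]
    congr 1
    refine prod_congr rfl fun i _ => ?_
    have h0 : (C (TrivSqZeroExt.inr a : R[ε])) * C (TrivSqZeroExt.inr a : R[ε]) = 0 := by
      rw [← map_mul, TrivSqZeroExt.inr_mul_inr, map_zero]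
    rw [map_sub, map_add]
    linear_combination - X ^ (i + 1) * X ^ (i + 1) * h0
  have h2 := congrArg epsDeriv h
  rw [epsDeriv_mul, epsDeriv_mul, epsDeriv_eulerProd_inl] at h2
  simp only [epsZero_eulerProd, TrivSqZeroExt.fst_add, TrivSqZeroExt.fst_sub,
    TrivSqZeroExt.fst_inl, TrivSqZeroExt.fst_inr, add_zero, sub_zero, mul_zero, zero_mul] at h2
  apply (isUnit_eulerProd (C a)).mul_left_cancel
  unfold eulerDeriv
  linear_combination h2

lemma inl_add_inr_pow (y : R) (k : ℕ) :
    (TrivSqZeroExt.inl y + TrivSqZeroExt.inr y : R[ε]) ^ k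
      = TrivSqZeroExt.inl (y ^ k) + TrivSqZeroExt.inr (k * y ^ k) := by
  induction k with
  | zero => ext <;> simp
  | succ k ih =>
    rw [pow_succ, ih]
    ext
    · simp [pow_succ]
    · simp
      ring

lemma inl_sub_inr_pow (y : R) (k : ℕ) :
    (TrivSqZeroExt.inl y - TrivSqZeroExt.inr y : R[ε]) ^ k
      = TrivSqZeroExt.inl (y ^ k) - TrivSqZeroExt.inr (k * y ^ k) := by
  induction k with
  | zero => ext <;> simp
  | succ k ih =>
    rw [pow_succ, ih]
    ext
    · simp [pow_succ]
    · simp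
      ring

lemma eulerProd_mul_crankMoment_mul {z y : R} (h : z * y = 1) :
    eulerProd (C z) * crankMoment z y * eulerProd (C y) ^ 2 * (1 - X)
      = (1 - X) * (eulerDeriv 1 * eulerProd (C y) - eulerProd 1 * eulerDeriv y)
        + X * eulerProd 1 * eulerProd (C y) := by
  set t : R[ε] := TrivSqZeroExt.inl y + TrivSqZeroExt.inr y with ht
  set x : R[ε] := TrivSqZeroExt.inl 1 + TrivSqZeroExt.inr 1 with hx
  have h1 := serSum_mul_eulerProd (c := qBinomTerm (TrivSqZeroExt.inl z : R[ε]))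
    (z := C (TrivSqZeroExt.inl z)) (by simp [qBinomTerm, qFac])
    (qBinomTerm_succ _) (X_pow_dvd_qBinomTerm _) (C t)
  have h2 : C (TrivSqZeroExt.inl z) * C t = C x := by
    rw [← map_mul, ht, hx, mul_add, TrivSqZeroExt.inl_mul_inl, TrivSqZeroExt.inl_mul_inr, h,
      smul_eq_mul, h]
  have h3 := eulerProd_eq_mul (C x)
  rw [← h2, ← h1, h2] at h3
  have hterm (k : ℕ) : C t ^ k * qBinomTerm (TrivSqZeroExt.inl z : R[ε]) k
      = C (t ^ k) * PowerSeries.map (TrivSqZeroExt.inlHom R R) (qBinomTerm z k) := by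
    rw [map_qBinomTerm, map_pow]
    rfl
  have hx1 : x.fst = 1 := by simp [hx]
  have hx2 : x.snd = 1 := by simp [hx]
  have ht1 : t.fst = y := by simp [ht]
  have hD : epsDeriv (1 - C x * X) = -X := by
    rw [epsDeriv_sub, epsDeriv_mul, epsDeriv_C, hx2, epsZero_X]
    have h4 := epsDeriv_X_pow (R := R) 0
    have h5 := epsDeriv_X_pow (R := R) 1
    rw [pow_zero] at h4
    rw [pow_one] at h5
    simp [h4, h5]
  have hF : epsZero (1 - C x * X) = 1 - X := by
    rw [map_sub, map_one, map_mul, epsZero_C, hx1, epsZero_X, map_one, one_mul]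
  have hS : epsDeriv (serSum fun k => C t ^ k * qBinomTerm (TrivSqZeroExt.inl z : R[ε]) k)
      = serSum fun k => C ((k : R) * y ^ k) * qBinomTerm z k := by
    rw [epsDeriv_serSum]
    congr 1
    ext1 k
    rw [hterm, epsDeriv_mul, epsDeriv_map, mul_zero, zero_add, epsZero_map, epsDeriv_C, ht,
      inl_add_inr_pow]
    simp
  have e0 := congrArg epsZero h3
  have e1 := congrArg epsDeriv h3
  rw [epsDeriv_mul, epsDeriv_mul, hD, hF, hS, map_mul, epsZero_eulerProd, ht1] at e1
  rw [map_mul, map_mul, hF, epsZero_eulerProd, epsZero_eulerProd, ht1, hx1, map_one] at e0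
  have e2 := eulerProd_mul_crankMoment z y
  have hd1 : epsDeriv (eulerProd (C x)) = eulerDeriv 1 := rfl
  have hdy : epsDeriv (eulerProd (C t)) = eulerDeriv y := rfl
  rw [hd1, hdy] at e1
  linear_combination (eulerProd (C y) ^ 2 * (1 - X)) * e2 - (1 - X) * eulerProd (C y) * e1
    + (eulerDeriv y * (1 - X) - X * eulerProd (C y)) * e0

theorem crankMoment_sub_mul {z y : R} (h : z * y = 1) :
    (crankMoment z y - crankMoment y z) * (eulerProd (C z) * eulerProd (C y)) ^ 2
      = triSeries fun n => (-1) ^ n *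
          ∑ i ∈ range n, ((i : R) + 1) * (z ^ (i + 1) - y ^ (i + 1)) := by
  have h1 := eulerProd_mul_crankMoment_mul h
  have h2 := eulerProd_mul_crankMoment_mul ((mul_comm y z).trans h)
  have hu : IsUnit (1 - X : R⟦X⟧) := by
    rw [isUnit_iff_constantCoeff]
    simp
  have h3 : (crankMoment z y - crankMoment y z) * (eulerProd (C z) * eulerProd (C y)) ^ 2
      = eulerProd 1 * (eulerDeriv z * eulerProd (C y) - eulerDeriv y * eulerProd (C z)) := by
    apply hu.mul_left_cancel
    linear_combination eulerProd (C z) * h1 - eulerProd (C y) * h2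
  set u : R[ε] := TrivSqZeroExt.inl z + TrivSqZeroExt.inr z with hu'
  set v : R[ε] := TrivSqZeroExt.inl y - TrivSqZeroExt.inr y with hv'
  have huv : u * v = 1 := by
    ext
    · simp [hu', hv', h]
    · simp [hu', hv']
  have h4 := congrArg epsDeriv (eulerProd_triple huv)
  have h5 : epsDeriv (eulerProd (1 : R[ε]⟦X⟧)) = 0 := by
    simpa using epsDeriv_eulerProd_inl (1 : R)
  have h6 : epsZero (eulerProd (1 : R[ε]⟦X⟧)) = eulerProd 1 := by
    simpa using epsZero_eulerProd (1 : R[ε])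
  rw [epsDeriv_mul, epsDeriv_mul, h5, h6, epsZero_eulerProd, epsZero_eulerProd, hv',
    epsDeriv_eulerProd_sub, hu', ← eulerDeriv] at h4
  rw [h3, triSeries]
  simp only [TrivSqZeroExt.fst_add, TrivSqZeroExt.fst_sub,
    TrivSqZeroExt.fst_inl, TrivSqZeroExt.fst_inr, add_zero, sub_zero, zero_mul] at h4
  trans epsDeriv (triSeries fun n => (-1) ^ n * symSum u v n)
  · rw [← h4]
    ring
  · rw [triSeries, epsDeriv_serSum]
    congr 1
    ext1 n
    have hs : ((-1) ^ n * symSum u v n).snd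
        = (-1) ^ n *
          ∑ i ∈ range n, ((i : R) + 1) * (z ^ (i + 1) - y ^ (i + 1)) := by
      have : ((-1) ^ n : R[ε]) = TrivSqZeroExt.inl ((-1) ^ n) := by
        rw [← TrivSqZeroExt.inl_one, ← TrivSqZeroExt.inl_neg, TrivSqZeroExt.inl_pow]
      rw [this, symSum, TrivSqZeroExt.snd_mul]
      simp only [hu', hv', inl_add_inr_pow, inl_sub_inr_pow]
      simp only [TrivSqZeroExt.snd_add, TrivSqZeroExt.snd_sum, TrivSqZeroExt.snd_inl,
        TrivSqZeroExt.fst_inl, TrivSqZeroExt.snd_one, TrivSqZeroExt.snd_sub,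
        TrivSqZeroExt.snd_inr, smul_zero, add_zero, zero_add, zero_sub, smul_eq_mul]
      congr 1
      refine sum_congr rfl fun i _ => ?_
      push_cast
      ring
    rw [epsDeriv_mul, epsDeriv_X_pow, mul_zero, zero_add, epsDeriv_C, hs]
    simp [epsZero_X]
end DualNumberIdentity

section Dissection
variable {R : Type*} [CommRing R]

/-- the substitution `X ↦ X⁵` -/
noncomputable def expandFive : R⟦X⟧ →ₐ[R] R⟦X⟧ := PowerSeries.expand 5 (by norm_num)

lemma coeff_expandFive_mul (f : R⟦X⟧) (n : ℕ) : coeff (5 * n) (expandFive f) = coeff n f :=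
  coeff_expand_mul ..

lemma coeff_expandFive_of_not_dvd (f : R⟦X⟧) {n : ℕ} (h : ¬ 5 ∣ n) :
    coeff n (expandFive f) = 0 :=
  coeff_expand_of_not_dvd _ _ _ h

/-- the series of coefficients with index in the class of `r` modulo `5` -/
noncomputable def sectFive (r : ℕ) (f : R⟦X⟧) : R⟦X⟧ := mk fun n => coeff (5 * n + r) f

lemma coeff_sectFive (r : ℕ) (f : R⟦X⟧) (n : ℕ) :
    coeff n (sectFive r f) = coeff (5 * n + r) f := coeff_mk _ _

lemma sectFive_add (r : ℕ) (f g : R⟦X⟧) : sectFive r (f + g) = sectFive r f + sectFive r g := by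
  ext n; simp [coeff_sectFive]

lemma sectFive_expandFive_mul {r : ℕ} (hr : r < 5) (f g : R⟦X⟧) :
    sectFive r (expandFive g * f) = g * sectFive r f := by
  ext n
  rw [coeff_sectFive, coeff_mul, coeff_mul]
  symm
  refine sum_of_injOn (fun p => (5 * p.1, 5 * p.2 + r)) ?_ ?_ ?_ ?_
  · intro p _ p' _ h
    simp only [Prod.mk.injEq] at h
    ext <;> omega
  · intro p hp
    simp only [mem_coe, HasAntidiagonal.mem_antidiagonal] at hp ⊢
    omega
  · rintro ⟨a, b⟩ hp hn
    by_cases h : 5 ∣ a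
    · exfalso
      apply hn
      obtain ⟨a, rfl⟩ := h
      simp only [HasAntidiagonal.mem_antidiagonal] at hp
      refine ⟨(a, (b - r) / 5), ?_, ?_⟩
      · simp only [mem_coe, HasAntidiagonal.mem_antidiagonal]
        omega
      · exact Prod.ext rfl (by dsimp; omega)
    · rw [coeff_expandFive_of_not_dvd _ h, zero_mul]
  · intro p _
    rw [coeff_expandFive_mul, coeff_sectFive]

lemma sectFive_X_pow {r i : ℕ} (hr : r < 5) (hi : i < 5) :
    sectFive r (X ^ i : R⟦X⟧) = if i = r then 1 else 0 := by
  ext n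
  rw [coeff_sectFive, coeff_X_pow]
  split_ifs with h1 h2 h2
  · rw [coeff_one, if_pos (by omega)]
  · omega
  · rw [coeff_one, if_neg (by omega)]
  · rw [map_zero]

lemma sectFive_expandFive_mul_X_pow {r i : ℕ} (hr : r < 5) (hi : i < 5) (f : R⟦X⟧) :
    sectFive r (expandFive f * X ^ i) = if i = r then f else 0 := by
  rw [sectFive_expandFive_mul hr, sectFive_X_pow hr hi]
  split_ifs <;> simp

lemma eq_expandFive_sectFive_mul {r : ℕ} {f : R⟦X⟧}
    (h : ∀ m, coeff m f ≠ 0 → m % 5 = r) : f = expandFive (sectFive r f) * X ^ r := by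
  ext m
  rw [coeff_mul_X_pow']
  split_ifs with h1
  · by_cases h2 : 5 ∣ m - r
    · obtain ⟨k, hk⟩ := h2
      rw [hk, coeff_expandFive_mul, coeff_sectFive, ← hk, Nat.sub_add_cancel h1]
    · rw [coeff_expandFive_of_not_dvd _ h2]
      by_contra h3
      have := h m h3
      omega
  · by_contra h3
    have := h m h3
    omega

lemma triSeries_add (a b : ℕ → R) :
    triSeries (fun n => a n + b n) = triSeries a + triSeries b := by
  ext m
  simp only [map_add, coeff_triSeries, ← sum_add_distrib]
  exact sum_congr rfl fun k _ => by split_ifs <;> simp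

lemma triSeries_mul (c : R) (a : ℕ → R) :
    triSeries (fun n => c * a n) = C c * triSeries a := by
  ext m
  simp only [coeff_C_mul, coeff_triSeries, mul_sum]
  exact sum_congr rfl fun k _ => by split_ifs <;> simp

lemma exists_of_coeff_triSeries_ne_zero {a : ℕ → R} {m : ℕ} (h : coeff m (triSeries a) ≠ 0) :
    ∃ n, tri n = m ∧ a n ≠ 0 := by
  by_cases h1 : ∃ n, tri n = m
  · obtain ⟨n, rfl⟩ := h1
    exact ⟨n, rfl, by rwa [coeff_triSeries_tri] at h⟩
  · exact absurd (coeff_triSeries_of_ne a (by simpa using h1)) h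

lemma tri_add_five (n : ℕ) : tri (n + 5) = tri n + 5 * (n + 3) := by
  simp only [tri_succ]
  ring

lemma tri_mod_five (n : ℕ) : tri n % 5 = tri (n % 5) % 5 := by
  induction n using Nat.strong_induction_on with
  | _ n ih =>
    rcases lt_or_ge n 5 with h | h
    · rw [Nat.mod_eq_of_lt h]
    · obtain ⟨k, rfl⟩ := Nat.exists_eq_add_of_le' h
      rw [tri_add_five, Nat.add_mod_right, ← ih k (by omega)]
      omega

lemma tri_mod_five_cases (n : ℕ) :
    n % 5 = 0 ∧ tri n % 5 = 0 ∨ n % 5 = 1 ∧ tri n % 5 = 1 ∨ n % 5 = 2 ∧ tri n % 5 = 3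
      ∨ n % 5 = 3 ∧ tri n % 5 = 1 ∨ n % 5 = 4 ∧ tri n % 5 = 0 := by
  rw [tri_mod_five n]
  have : n % 5 < 5 := Nat.mod_lt _ (by norm_num)
  interval_cases n % 5 <;> simp [tri]

lemma tri_five_mul_add_two (k : ℕ) : tri (5 * k + 2) = 5 * (5 * tri k) + 3 := by
  have h1 := two_mul_tri (5 * k + 2)
  have h2 := two_mul_tri k
  nlinarith

lemma sectFive_triSeries_of_ne {a : ℕ → R} {r : ℕ} (h : r = 2 ∨ r = 4) :
    sectFive r (triSeries a) = 0 := by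
  ext m
  rw [coeff_sectFive, map_zero]
  refine coeff_triSeries_of_ne _ fun n hn => ?_
  have := tri_mod_five_cases n
  omega

lemma sectFive_X_mul {r : ℕ} (f : R⟦X⟧) : sectFive (r + 1) (X * f) = sectFive r f := by
  ext m
  rw [coeff_sectFive, coeff_sectFive, ← add_assoc, coeff_succ_X_mul]

lemma sectFive_three_triSeries {a b : ℕ → R} (h : ∀ k, a (5 * k + 2) = b k) :
    sectFive 3 (triSeries a) = expandFive (triSeries b) := by
  ext m
  rw [coeff_sectFive]
  by_cases h1 : ∃ k, m = 5 * tri k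
  · obtain ⟨k, rfl⟩ := h1
    rw [coeff_expandFive_mul, coeff_triSeries_tri, ← tri_five_mul_add_two, coeff_triSeries_tri, h]
  · rw [coeff_triSeries_of_ne]
    · by_cases h2 : 5 ∣ m
      · obtain ⟨m, rfl⟩ := h2
        rw [coeff_expandFive_mul, coeff_triSeries_of_ne]
        rintro n rfl
        exact h1 ⟨n, rfl⟩
      · rw [coeff_expandFive_of_not_dvd _ h2]
    · intro n hn
      have := tri_mod_five_cases n
      obtain ⟨k, rfl⟩ : ∃ k, n = 5 * k + 2 := ⟨n / 5, by omega⟩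
      rw [tri_five_mul_add_two] at hn
      exact h1 ⟨k, by omega⟩

lemma eulerProd_one_eq_pentagonalSeries : eulerProd (1 : R⟦X⟧) = pentagonalSeries R := by
  ext n
  have h := (Filter.tendsto_finset_range.eventually
    (coeff_prod_one_sub_X_pow_eventually_eq R n)).and (Filter.eventually_ge_atTop n)
  obtain ⟨M, hM, hn⟩ := h.exists
  rw [← hM]
  simpa using modX_eq_iff_coeff.1 (modX_eulerProd (1 : R⟦X⟧) (le_refl (M + 1))) n (by omega)

lemma pentagonal_mod_five {k : ℤ} {n : ℕ} (h : pentagonal k = 5 * n + 1) :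
    ∃ m : ℤ, k = 5 * m + 1 ∧ n = 5 * pentagonal (-m) := by
  have h1 := two_mul_natCast_pentagonal k
  have h3 : k % 5 = 1 := by
    have h4 : (k * (3 * k - 1)) % 5 = 2 := by rw [← h1, h]; omega
    have h5 : k % 5 = 0 ∨ k % 5 = 1 ∨ k % 5 = 2 ∨ k % 5 = 3 ∨ k % 5 = 4 := by omega
    rcases h5 with h5 | h5 | h5 | h5 | h5 <;>
      simp [Int.mul_emod, Int.sub_emod, h5] at h4 ⊢
  obtain ⟨m, rfl⟩ : ∃ m, k = 5 * m + 1 := ⟨k / 5, by omega⟩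
  have h6 := two_mul_natCast_pentagonal_neg m
  refine ⟨m, rfl, ?_⟩
  rw [h] at h1
  push_cast at h1
  zify
  nlinarith

lemma sectFive_one_eulerProd_one :
    sectFive 1 (eulerProd (1 : R⟦X⟧)) = -expandFive (eulerProd 1) := by
  rw [eulerProd_one_eq_pentagonalSeries]
  ext n
  rw [coeff_sectFive, map_neg]
  by_cases h : ∃ m : ℤ, n = 5 * pentagonal (-m)
  · obtain ⟨m, rfl⟩ := h
    have h1 : 5 * (5 * pentagonal (-m)) + 1 = pentagonal (5 * m + 1) := by
      have h2 := two_mul_natCast_pentagonal_neg m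
      have h3 := two_mul_natCast_pentagonal (5 * m + 1)
      zify
      nlinarith
    rw [h1, coeff_pentagonalSeries_pentagonal, coeff_expandFive_mul,
      coeff_pentagonalSeries_pentagonal, Int.negOnePow_neg]
    have : Int.negOnePow (5 * m + 1) = - Int.negOnePow m := by
      rw [Int.negOnePow_succ, neg_inj, Int.negOnePow_eq_iff]
      exact ⟨2 * m, by ring⟩
    rw [this]
    simp
  · rw [coeff_pentagonalSeries_eq_zero]
    · by_cases h2 : 5 ∣ n
      · obtain ⟨n, rfl⟩ := h2
        rw [coeff_expandFive_mul, coeff_pentagonalSeries_eq_zero, neg_zero]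
        rintro ⟨k, rfl⟩
        exact h ⟨-k, by simp⟩
      · rw [coeff_expandFive_of_not_dvd _ h2, neg_zero]
    · rintro ⟨k, hk⟩
      obtain ⟨m, -, hm⟩ := pentagonal_mod_five hk
      exact h ⟨m, hm⟩

end Dissection

section FifthRoots
variable {R : Type*} [CommRing R] {w : R}

lemma sum_fifth_roots_sq (h : 1 + w + w ^ 2 + w ^ 3 + w ^ 4 = 0) :
    1 + w ^ 2 + (w ^ 2) ^ 2 + (w ^ 2) ^ 3 + (w ^ 2) ^ 4 = 0 := by
  linear_combination (1 - w + w ^ 2 - w ^ 3 + w ^ 4) * h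

lemma pow_five_eq_one (h : 1 + w + w ^ 2 + w ^ 3 + w ^ 4 = 0) : w ^ 5 = 1 := by
  linear_combination (w - 1) * h

lemma symSum_five_mul_add (h : 1 + w + w ^ 2 + w ^ 3 + w ^ 4 = 0) (k r : ℕ) :
    symSum w (w ^ 4) (5 * k + r) = symSum w (w ^ 4) r := by
  induction k with
  | zero => simp
  | succ k ih =>
    rw [← ih, show 5 * (k + 1) + r = 5 * k + r + 1 + 1 + 1 + 1 + 1 by ring]
    simp only [symSum_succ, ← pow_mul]
    linear_combination (w ^ (5 * k + r + 1) + w ^ (4 * (5 * k + r) + 4)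
      * (w ^ 12 - w ^ 11 + w ^ 8 - w ^ 6 + w ^ 4 - w + 1)) * h

/-- the part of the theta coefficients supported on indices `0, 4` modulo `5` -/
def thetaZero (R : Type*) [CommRing R] (n : ℕ) : R :=
  (-1) ^ n * if n % 5 = 0 then 1 else if n % 5 = 4 then -1 else 0

/-- the part of the theta coefficients supported on indices `1, 3` modulo `5` -/
def thetaOne (R : Type*) [CommRing R] (n : ℕ) : R :=
  (-1) ^ n * if n % 5 = 1 then 1 else if n % 5 = 3 then -1 else 0

lemma symSum_eq_thetaZero_add (h : 1 + w + w ^ 2 + w ^ 3 + w ^ 4 = 0) (n : ℕ) :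
    (-1) ^ n * symSum w (w ^ 4) n
      = thetaZero R n + (1 + w + w ^ 4) * thetaOne R n := by
  have h1 := symSum_five_mul_add h (n / 5) (n % 5)
  rw [Nat.div_add_mod] at h1
  rw [h1, thetaZero, thetaOne]
  have : n % 5 < 5 := Nat.mod_lt _ (by norm_num)
  have h5 := pow_five_eq_one h
  suffices symSum w (w ^ 4) (n % 5)
      = (if n % 5 = 0 then 1 else if n % 5 = 4 then -1 else 0)
        + (1 + w + w ^ 4) * if n % 5 = 1 then 1 else if n % 5 = 3 then -1 else 0 by
    rw [this]; ring
  interval_cases n % 5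
  · simp [symSum]
  · simp [symSum]; ring
  · simp [symSum, sum_range_succ]
    linear_combination h + w ^ 3 * h5
  · simp [symSum, sum_range_succ]
    linear_combination 2 * h + (w ^ 7 + w ^ 3 + w ^ 2) * h5
  · simp [symSum, sum_range_succ]
    linear_combination 2 * h + (w ^ 11 + w ^ 7 + w ^ 6 + w ^ 3 + w ^ 2 + w) * h5

lemma sum_weighted_powers (h : 1 + w + w ^ 2 + w ^ 3 + w ^ 4 = 0) (k : ℕ) :
    ∑ i ∈ range (5 * k + 2), ((i : R) + 1) * (w ^ (i + 1) - (w ^ 4) ^ (i + 1))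
      = (2 * (k : R) + 1) * (w + 2 * w ^ 2 - 2 * w ^ 3 - w ^ 4) := by
  have h5 := pow_five_eq_one h
  induction k with
  | zero =>
    simp [sum_range_succ]
    linear_combination -2 * w ^ 3 * h5
  | succ k ih =>
    have hk (j : ℕ) : w ^ (5 * k + j) = w ^ j := by rw [pow_add, pow_mul, h5]; simp
    have hk4 (j : ℕ) : (w ^ 4) ^ (5 * k + j) = w ^ (4 * j) := by
      rw [pow_add, pow_mul, ← pow_mul w 4 5, mul_comm 4 5, pow_mul w 5 4, h5]
      simp [pow_mul]
    rw [show 5 * (k + 1) + 2 = 5 * k + 2 + 1 + 1 + 1 + 1 + 1 by ring]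
    rw [sum_range_succ, sum_range_succ, sum_range_succ, sum_range_succ, sum_range_succ, ih]
    simp only [add_assoc, hk, hk4]
    push_cast
    linear_combination (-(5 * (k : R) + 3) * w ^ 2 * (w ^ 5 + 1)
      - (5 * (k : R) + 4) * w * (w ^ 10 + w ^ 5 + 1)
      - (5 * (k : R) + 5) * w ^ 5 * (w ^ 10 + w ^ 5 + 1)
      + (5 * (k : R) + 6) * (w - w ^ 4 * (w ^ 15 + w ^ 10 + w ^ 5 + 1))
      + (5 * (k : R) + 7) * (w ^ 2 - w ^ 3 * (w ^ 20 + w ^ 15 + w ^ 10 + w ^ 5 + 1))) * h5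

lemma prod_one_sub_fifth_roots (h : 1 + w + w ^ 2 + w ^ 3 + w ^ 4 = 0) (Y : R⟦X⟧) :
    (1 - Y) * ((1 - C w * Y) * (1 - C (w ^ 4) * Y))
      * ((1 - C (w ^ 2) * Y) * (1 - C ((w ^ 2) ^ 4) * Y)) = 1 - Y ^ 5 := by
  have h' : (1 : R⟦X⟧) + C w + C w ^ 2 + C w ^ 3 + C w ^ 4 = 0 := by
    simp only [← map_pow, ← map_one (C : R →+* R⟦X⟧), ← map_add, h, map_zero]
  have h5 : (C w : R⟦X⟧) ^ 5 = 1 := pow_five_eq_one h'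
  have h8 : (C ((w ^ 2) ^ 4) : R⟦X⟧) = C w ^ 3 := by
    rw [← map_pow]; congr 1
    linear_combination w ^ 3 * pow_five_eq_one h
  rw [h8]
  simp only [map_pow]
  generalize (C w : R⟦X⟧) = v at h' h5
  have h1 : (1 - v * Y) * (1 - v ^ 4 * Y) = 1 - (v + v ^ 4) * Y + Y ^ 2 := by
    linear_combination Y ^ 2 * h5
  have h2 : (1 - v ^ 2 * Y) * (1 - v ^ 3 * Y) = 1 - (v ^ 2 + v ^ 3) * Y + Y ^ 2 := by
    linear_combination Y ^ 2 * h5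
  have h3 : (v + v ^ 4) + (v ^ 2 + v ^ 3) = -1 := by linear_combination h'
  have h4 : (v + v ^ 4) * (v ^ 2 + v ^ 3) = -1 := by
    linear_combination h' + (v + v ^ 2) * h5
  rw [h1, h2]
  linear_combination (1 - Y) * (-(Y + Y ^ 3) * h3 + Y ^ 2 * h4)

lemma modX_expandFive {f g : R⟦X⟧} {N : ℕ} (h : modX N f = modX N g) :
    modX N (expandFive f) = modX N (expandFive g) := by
  rw [modX_eq_iff_coeff] at h ⊢
  intro n hn
  by_cases h2 : 5 ∣ n
  · obtain ⟨n, rfl⟩ := h2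
    rw [coeff_expandFive_mul, coeff_expandFive_mul, h n (by omega)]
  · rw [coeff_expandFive_of_not_dvd _ h2, coeff_expandFive_of_not_dvd _ h2]

lemma prod_eulerProd_fifth_roots (h : 1 + w + w ^ 2 + w ^ 3 + w ^ 4 = 0) :
    eulerProd 1 * (eulerProd (C w) * eulerProd (C (w ^ 4)))
      * (eulerProd (C (w ^ 2)) * eulerProd (C ((w ^ 2) ^ 4)))
      = expandFive (eulerProd (1 : R⟦X⟧)) := by
  refine eq_of_modX_eq fun N => ?_
  rw [modX_expandFive (modX_eulerProd 1 (le_add_right (le_refl N) : N ≤ N + 1))]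
  simp only [map_mul, modX_eulerProd _ (le_add_right (le_refl N) : N ≤ N + 1)]
  simp only [← map_mul, ← prod_mul_distrib, one_mul]
  congr 1
  rw [map_prod]
  refine prod_congr rfl fun i _ => ?_
  rw [prod_one_sub_fifth_roots h, map_sub, map_one, map_pow]
  congr 1
  rw [expandFive, expand_X, ← pow_mul, ← pow_mul, mul_comm]

end FifthRoots

section FifthRootsCrank
variable {R : Type*} [CommRing R] {w : R}

lemma eulerProd_triple_fifth_roots (h : 1 + w + w ^ 2 + w ^ 3 + w ^ 4 = 0) :
    eulerProd 1 * (eulerProd (C w) * eulerProd (C (w ^ 4)))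
      = expandFive (sectFive 0 (triSeries (thetaZero R)))
        + C (1 + w + w ^ 4) * (expandFive (sectFive 1 (triSeries (thetaOne R))) * X) := by
  have hw : w * w ^ 4 = 1 := by linear_combination pow_five_eq_one h
  rw [eulerProd_triple hw]
  simp only [symSum_eq_thetaZero_add h]
  rw [triSeries_add, triSeries_mul]
  congr 1
  · conv_lhs => rw [eq_expandFive_sectFive_mul (r := 0) (f := triSeries (thetaZero R)) (by
      intro m hm
      obtain ⟨n, rfl, hn⟩ := exists_of_coeff_triSeries_ne_zero hm
      have := tri_mod_five_cases n
      contrapose! hn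
      rw [thetaZero, if_neg (by omega), if_neg (by omega), mul_zero])]
    rw [pow_zero, mul_one]
  · congr 1
    conv_lhs => rw [eq_expandFive_sectFive_mul (r := 1) (f := triSeries (thetaOne R)) (by
      intro m hm
      obtain ⟨n, rfl, hn⟩ := exists_of_coeff_triSeries_ne_zero hm
      have := tri_mod_five_cases n
      contrapose! hn
      rw [thetaOne, if_neg (by omega), if_neg (by omega), mul_zero])]
    rw [pow_one]

lemma sectFive_thetaZero_mul_thetaOne (h : 1 + w + w ^ 2 + w ^ 3 + w ^ 4 = 0) :
    sectFive 0 (triSeries (thetaZero R)) * sectFive 1 (triSeries (thetaOne R))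
      = - (eulerProd 1 * expandFive (eulerProd 1)) := by
  have h1 := eulerProd_triple_fifth_roots h
  have h2 := eulerProd_triple_fifth_roots (sum_fifth_roots_sq h)
  set u : R⟦X⟧ := sectFive 0 (triSeries (thetaZero R))
  set v : R⟦X⟧ := sectFive 1 (triSeries (thetaOne R))
  have h3 : expandFive (eulerProd 1) * eulerProd (1 : R⟦X⟧)
      = expandFive (u ^ 2) * X ^ 0 + expandFive (u * v) * X ^ 1
        + expandFive (C ((1 + w + w ^ 4) * (1 + w ^ 2 + (w ^ 2) ^ 4)) * v ^ 2) * X ^ 2 := by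
    have h4 : (1 + w + w ^ 4) + (1 + w ^ 2 + (w ^ 2) ^ 4) = 1 := by
      linear_combination h + w ^ 3 * pow_five_eq_one h
    have h5 : (C (1 + w + w ^ 4) : R⟦X⟧) + C (1 + w ^ 2 + (w ^ 2) ^ 4) = 1 := by
      rw [← map_add, h4, map_one]
    have h6 : expandFive (C ((1 + w + w ^ 4) * (1 + w ^ 2 + (w ^ 2) ^ 4)) : R⟦X⟧)
        = C (1 + w + w ^ 4) * C (1 + w ^ 2 + (w ^ 2) ^ 4) := by
      rw [← map_mul]
      exact expand_C _ _ _
    rw [← prod_eulerProd_fifth_roots h]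
    simp only [map_mul, map_pow] at h1 h2 h5 h6 ⊢
    rw [h6]
    linear_combination (eulerProd 1 * (eulerProd (C w ^ 2) * eulerProd ((C w ^ 2) ^ 4))) * h1
      + (expandFive u + C (1 + w + w ^ 4) * (expandFive v * X)) * h2
      + expandFive u * expandFive v * X * h5
  have h4 := congrArg (sectFive 1) h3
  rw [sectFive_expandFive_mul (by norm_num), sectFive_one_eulerProd_one, sectFive_add,
    sectFive_add, sectFive_expandFive_mul_X_pow (by norm_num) (by norm_num),
    sectFive_expandFive_mul_X_pow (by norm_num) (by norm_num),
    sectFive_expandFive_mul_X_pow (by norm_num) (by norm_num)] at h4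
  simp at h4
  exact h4.symm

theorem sectFive_crankMoment_sub (h : 1 + w + w ^ 2 + w ^ 3 + w ^ 4 = 0) :
    C (w ^ 4 - w) * sectFive 4 (crankMoment w (w ^ 4) - crankMoment (w ^ 4) w) * eulerProd 1
      = 10 * expandFive (eulerProd (1 : R⟦X⟧)) ^ 4 := by
  have h5 := pow_five_eq_one h
  have h1 := crankMoment_sub_mul (show w * w ^ 4 = 1 by linear_combination h5)
  have h2 := eulerProd_triple_fifth_roots (sum_fifth_roots_sq h)
  have h3 := sectFive_thetaZero_mul_thetaOne h
  have h4 := prod_eulerProd_fifth_roots h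
  set u : R⟦X⟧ := sectFive 0 (triSeries (thetaZero R))
  set v : R⟦X⟧ := sectFive 1 (triSeries (thetaOne R))
  set G : R⟦X⟧ := crankMoment w (w ^ 4) - crankMoment (w ^ 4) w
  set s : R := 1 + w ^ 2 + (w ^ 2) ^ 4 with hs
  set κ : R := w + 2 * w ^ 2 - 2 * w ^ 3 - w ^ 4 with hκ
  set E : R⟦X⟧ := triSeries fun n =>
    (-1) ^ n * ∑ i ∈ range n, ((i : R) + 1) * (w ^ (i + 1) - (w ^ 4) ^ (i + 1)) with hE
  have hE2 : sectFive 2 E = 0 := sectFive_triSeries_of_ne (.inl rfl)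
  have hE4 : sectFive 4 E = 0 := sectFive_triSeries_of_ne (.inr rfl)
  have hE3 : sectFive 3 E = expandFive (C κ * eulerProd 1 ^ 3) := by
    rw [eulerProd_one_pow_three, ← triSeries_mul]
    refine sectFive_three_triSeries fun k => ?_
    rw [sum_weighted_powers h, pow_add, pow_mul]
    norm_num
    ring
  have hG : expandFive (eulerProd 1 ^ 2) * G
      = expandFive (u ^ 2) * E + expandFive (2 * C s * (u * v)) * (X * E)
        + expandFive (C s ^ 2 * v ^ 2) * (X * (X * E)) := by
    have hC : expandFive (C s : R⟦X⟧) = C s := expand_C _ _ _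
    simp only [map_mul, map_pow, map_ofNat, hC]
    rw [← h4, ← h1]
    have := congrArg (fun t => t ^ 2) h2
    linear_combination (G * (eulerProd (C w) * eulerProd (C (w ^ 4))) ^ 2) * this
  have hG4 := congrArg (sectFive 4) hG
  rw [sectFive_expandFive_mul (by norm_num), sectFive_add, sectFive_add,
    sectFive_expandFive_mul (by norm_num), sectFive_expandFive_mul (by norm_num),
    sectFive_expandFive_mul (by norm_num), sectFive_X_mul, sectFive_X_mul, sectFive_X_mul,
    hE2, hE3, hE4, h3, map_mul, map_pow, mul_zero, mul_zero, zero_add, add_zero] at hG4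
  have hC : expandFive (C κ : R⟦X⟧) = C κ := expand_C _ _ _
  rw [hC] at hG4
  apply (isUnit_eulerProd (1 : R⟦X⟧)).mul_left_cancel
  have hsk : (w ^ 4 - w) * κ * s = -5 := by
    rw [hs, hκ]
    linear_combination (5 - 5 * w - w ^ 2 - w ^ 3 + 3 * w ^ 4 + 4 * w ^ 5 - w ^ 6 - 5 * w ^ 7 +
      4 * w ^ 10 - w ^ 11 - w ^ 12) * h
  have hsk' : (C (w ^ 4 - w) : R⟦X⟧) * C κ * C s = -5 := by
    rw [← map_mul, ← map_mul, hsk, map_neg, map_ofNat]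
  linear_combination C (w ^ 4 - w) * hG4
    - 2 * eulerProd 1 * expandFive (eulerProd 1) ^ 4 * hsk'

end FifthRootsCrank

section CrankMomentDifference
variable {R : Type*} [CommRing R] {w : R}

lemma fifth_root_indicator (h : 1 + w + w ^ 2 + w ^ 3 + w ^ 4 = 0) (e : ℕ) :
    (w ^ 4 - w) * (w ^ e - (w ^ e) ^ 4)
      + ((w ^ 2) ^ 4 - w ^ 2) * ((w ^ e) ^ 2 - ((w ^ e) ^ 2) ^ 4)
      = 5 * ((if e % 5 = 1 then 1 else 0) - if e % 5 = 4 then 1 else 0) := by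
  have h5 := pow_five_eq_one h
  rw [pow_eq_pow_mod e h5]
  have : e % 5 < 5 := Nat.mod_lt _ (by norm_num)
  interval_cases e % 5
  · simp
  · simp
    linear_combination (-5 + 5 * w - w ^ 2 + w ^ 3 - w ^ 4 - 2 * w ^ 5 + 3 * w ^ 6 - w ^ 7 + w ^
      11 - w ^ 12) * h
  · simp
    linear_combination (-w ^ 3 + w ^ 4 - w ^ 8 + 2 * w ^ 9 - w ^ 10 - w ^ 13 + 2 * w ^ 14 -
      w ^ 15 + w ^ 19 - w ^ 20) * h
  · simp
    linear_combination (-w ^ 4 + w ^ 5 + w ^ 7 - 2 * w ^ 8 + w ^ 10 + w ^ 12 - w ^ 13 - w ^ 16 +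
      2 * w ^ 17 - w ^ 18 - w ^ 21 + 2 * w ^ 22 - w ^ 23 + w ^ 27 - w ^ 28) * h
  · simp
    linear_combination (5 - 5 * w + 4 * w ^ 5 - 4 * w ^ 6 + w ^ 8 - w ^ 9 + 3 * w ^ 10 - 3 * w ^
      11 + w ^ 13 - w ^ 14 + 3 * w ^ 15 - 2 * w ^ 16 - w ^ 19 + 2 * w ^ 20 - w ^ 21 - w ^ 24 + 2 *
      w ^ 25 - w ^ 26 - w ^ 29 + 2 * w ^ 30 - w ^ 31 + w ^ 35 - w ^ 36) * h

lemma crank_emod_eq_iff {n : ℕ} (π : n.Partition) (hπ : omegaOnes π ≠ 0) {m : ℕ} (hm : m < 5) :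
    crank π % (5 : ℕ) = (m : ℤ) % (5 : ℕ) ↔ (muParts π + 4 * omegaOnes π) % 5 = m := by
  rw [crank, if_neg hπ]
  omega

lemma fifth_root_weight (h : 1 + w + w ^ 2 + w ^ 3 + w ^ 4 = 0) {n : ℕ} (π : n.Partition) :
    (w ^ 4 - w) * ((omegaOnes π : R) * (w ^ 4) ^ omegaOnes π * w ^ muParts π
        - omegaOnes π * w ^ omegaOnes π * (w ^ 4) ^ muParts π)
      + ((w ^ 2) ^ 4 - w ^ 2) * ((omegaOnes π : R) * ((w ^ 2) ^ 4) ^ omegaOnes π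
          * (w ^ 2) ^ muParts π
        - omegaOnes π * (w ^ 2) ^ omegaOnes π * ((w ^ 2) ^ 4) ^ muParts π)
      = 5 * (((if crank π % (5 : ℕ) = (1 : ℕ) % (5 : ℕ) then (omegaOnes π : ℤ) else 0 : ℤ) : R)
        - ((if crank π % (5 : ℕ) = (4 : ℕ) % (5 : ℕ) then (omegaOnes π : ℤ) else 0 : ℤ) : R)) := by
  by_cases hπ : omegaOnes π = 0
  · simp [hπ]
  simp only [crank_emod_eq_iff π hπ (show 1 < 5 by norm_num),
    crank_emod_eq_iff π hπ (show 4 < 5 by norm_num)]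
  have h1 := fifth_root_indicator h (muParts π + 4 * omegaOnes π)
  have h2 (v : R) (hv : v ^ 5 = 1) : v ^ omegaOnes π = (v ^ 4) ^ (4 * omegaOnes π) := by
    rw [← pow_mul, show 4 * (4 * omegaOnes π) = 5 * (3 * omegaOnes π) + omegaOnes π by ring,
      pow_add, pow_mul, hv, one_pow, one_mul]
  rw [h2 w (pow_five_eq_one h), h2 (w ^ 2) (pow_five_eq_one (sum_fifth_roots_sq h))]
  push_cast
  have h3 : ∀ p : Prop, ∀ _ : Decidable p, (if p then (omegaOnes π : R) else 0)
      = omegaOnes π * if p then 1 else 0 := by simp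
  rw [h3, h3]
  linear_combination (omegaOnes π : R) * h1

/-- the generating function of `M_ω(1,5,5n+4) - M_ω(4,5,5n+4)` -/
def MwDiffSeries (R : Type*) [CommRing R] : R⟦X⟧ :=
  mk fun n => ((Mw 1 5 (5 * n + 4) - Mw 4 5 (5 * n + 4) : ℤ) : R)

lemma five_mul_MwDiffSeries (h : 1 + w + w ^ 2 + w ^ 3 + w ^ 4 = 0) :
    C (w ^ 4 - w) * sectFive 4 (crankMoment w (w ^ 4) - crankMoment (w ^ 4) w)
      + C ((w ^ 2) ^ 4 - w ^ 2)
        * sectFive 4 (crankMoment (w ^ 2) ((w ^ 2) ^ 4) - crankMoment ((w ^ 2) ^ 4) (w ^ 2))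
      = 5 * MwDiffSeries R := by
  ext n
  rw [show (5 : R⟦X⟧) = C 5 from (map_ofNat C 5).symm]
  rw [map_add, coeff_C_mul, coeff_C_mul, coeff_C_mul, coeff_sectFive, coeff_sectFive]
  simp only [map_sub, crankMoment, coeff_mk, MwDiffSeries,
    Mw, Int.cast_sub, Int.cast_sum, ← sum_sub_distrib, mul_sum, ← sum_add_distrib]
  exact sum_congr rfl fun π _ => fifth_root_weight h π

theorem MwDiffSeries_mul_eulerProd :
    MwDiffSeries ℂ * eulerProd 1 = 4 * expandFive (eulerProd 1) ^ 4 := by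
  obtain ⟨w, hw⟩ : ∃ w : ℂ, IsPrimitiveRoot w 5 :=
    ⟨_, Complex.isPrimitiveRoot_exp 5 (by norm_num)⟩
  have h : 1 + w + w ^ 2 + w ^ 3 + w ^ 4 = 0 := by
    have := hw.geom_sum_eq_zero (by norm_num)
    simpa [sum_range_succ] using this
  have h5 : (C (5 : ℂ)) * C (5⁻¹) = 1 := by rw [← map_mul]; norm_num
  rw [map_ofNat] at h5
  have h1 := five_mul_MwDiffSeries h
  have h2 := sectFive_crankMoment_sub h
  have h3 := sectFive_crankMoment_sub (sum_fifth_roots_sq h)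
  have h4 : 5 * (MwDiffSeries ℂ * eulerProd 1) = 5 * (4 * expandFive (eulerProd 1) ^ 4) := by
    linear_combination h2 + h3 - eulerProd 1 * h1
  linear_combination C (5⁻¹) * h4 - (MwDiffSeries ℂ * eulerProd 1
    - 4 * expandFive (eulerProd 1) ^ 4) * h5

end CrankMomentDifference

section DiscExpansion
open Filter Topology Metric

/-- `f` is represented on the open unit disc by the power series `a` -/
def HasDiscSeries (f : ℂ → ℂ) (a : ℂ⟦X⟧) : Prop :=
  ∀ q : ℂ, ‖q‖ < 1 → HasSum (fun n => coeff n a * q ^ n) (f q)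

variable {f g : ℂ → ℂ} {a b : ℂ⟦X⟧}

lemma HasDiscSeries.coeff_eq (hf : HasDiscSeries f a) (n : ℕ) :
    coeff n a = iteratedDeriv n f 0 / n.factorial := by
  have h : HasFPowerSeriesAt f (FormalMultilinearSeries.ofScalars ℂ fun n => coeff n a) 0 := by
    rw [hasFPowerSeriesAt_iff]
    filter_upwards [ball_mem_nhds (0 : ℂ) one_pos] with z hz
    simpa [mul_comm] using hf z (by simpa using hz)
  have := congrArg (fun p => FormalMultilinearSeries.coeff p n)
    (h.eq_formalMultilinearSeries h.analyticAt.hasFPowerSeriesAt)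
  simpa using this

lemma HasDiscSeries.unique (hf : HasDiscSeries f a) (hg : HasDiscSeries f b) : a = b := by
  ext n
  rw [hf.coeff_eq, hg.coeff_eq]

lemma hasDiscSeries_of_differentiableOn (hf : DifferentiableOn ℂ f (ball 0 1)) :
    HasDiscSeries f (mk fun n => iteratedDeriv n f 0 / n.factorial) := by
  intro q hq
  refine (Complex.hasSum_taylorSeries_on_ball hf (z := q) (by simpa using hq)).congr_fun ?_
  intro n
  rw [coeff_mk, sub_zero, smul_eq_mul, smul_eq_mul]
  ring

lemma HasDiscSeries.mul (hf : HasDiscSeries f a) (hg : HasDiscSeries g b) :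
    HasDiscSeries (fun q => f q * g q) (a * b) := by
  intro q hq
  change HasSum _ (f q * g q)
  have h1 := (hf q hq).summable.norm
  have h2 := (hg q hq).summable.norm
  rw [← (hf q hq).tsum_eq, ← (hg q hq).tsum_eq,
    tsum_mul_tsum_eq_tsum_sum_antidiagonal_of_summable_norm h1 h2]
  refine (summable_norm_sum_mul_antidiagonal_of_summable_norm h1 h2).of_norm.hasSum.congr_fun ?_
  intro n
  rw [coeff_mul, sum_mul]
  refine sum_congr rfl fun i hi => ?_
  rw [← mem_antidiagonal.1 hi, pow_add]
  ring

lemma HasDiscSeries.sub (hf : HasDiscSeries f a) (hg : HasDiscSeries g b) :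
    HasDiscSeries (fun q => f q - g q) (a - b) := fun q hq => by
  simpa [sub_mul] using (hf q hq).sub (hg q hq)

lemma hasDiscSeries_C (c : ℂ) : HasDiscSeries (fun _ => c) (C c) := fun q _ => by
  convert hasSum_single (f := fun n => coeff n (C c) * q ^ n) 0 fun n hn => ?_ using 1
  · simp
  · simp [coeff_C, hn]

lemma hasDiscSeries_X_pow (k : ℕ) : HasDiscSeries (fun q => q ^ k) (X ^ k) := fun q _ => by
  convert hasSum_single (f := fun n => coeff n (X ^ k : ℂ⟦X⟧) * q ^ n) k fun n hn => ?_ using 1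
  · simp
  · simp [coeff_X_pow, hn]

lemma HasDiscSeries.pow (hf : HasDiscSeries f a) (k : ℕ) :
    HasDiscSeries (fun q => f q ^ k) (a ^ k) := by
  induction k with
  | zero => simpa using hasDiscSeries_C 1
  | succ k ih => simpa only [pow_succ] using ih.mul hf

lemma HasDiscSeries.comp_pow_five (hf : HasDiscSeries f a) :
    HasDiscSeries (fun q => f (q ^ 5)) (expandFive a) := by
  intro q hq
  have h := hf (q ^ 5) (by rw [norm_pow]; exact pow_lt_one₀ (norm_nonneg _) hq (by norm_num))
  have hinj : Function.Injective fun n : ℕ => 5 * n := fun m n h => by simpa using h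
  rw [← hinj.hasSum_iff]
  · convert h using 2 with n
    simp only [Function.comp_apply, coeff_expandFive_mul, pow_mul]
  · intro n hn
    rw [coeff_expandFive_of_not_dvd, zero_mul]
    rintro ⟨m, rfl⟩
    exact hn ⟨m, rfl⟩

lemma tendstoLocallyUniformlyOn_iteratedDeriv {U : Set ℂ} (hU : IsOpen U) {F : ℕ → ℂ → ℂ}
    (hF : TendstoLocallyUniformlyOn F f atTop U) (hd : ∀ k, ContDiff ℂ ⊤ (F k)) (n : ℕ) :
    TendstoLocallyUniformlyOn (fun k => iteratedDeriv n (F k)) (iteratedDeriv n f) atTop U := by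
  induction n with
  | zero => simpa using hF
  | succ n ih =>
    simp only [iteratedDeriv_succ]
    refine ih.deriv (.of_forall fun k => ?_) hU
    exact ((hd k).differentiable_iteratedDeriv n (WithTop.coe_lt_top _)).differentiableOn

lemma hasDiscSeries_finset_prod (k : ℕ) :
    HasDiscSeries (fun q => ∏ i ∈ range k, (1 - q ^ (i + 1)))
      (∏ i ∈ range k, (1 - 1 * X ^ (i + 1))) := by
  induction k with
  | zero => simpa using hasDiscSeries_C 1
  | succ k ih =>
    simp only [prod_range_succ]
    refine ih.mul ?_
    simpa using (hasDiscSeries_C 1).sub (hasDiscSeries_X_pow (k + 1))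

lemma poch_self (q : ℂ) : poch q q = ∏' n : ℕ, (1 - q ^ (n + 1)) := by
  simp only [poch, pow_succ']

lemma differentiableOn_poch_self : DifferentiableOn ℂ (fun q => poch q q) (ball 0 1) := by
  simpa only [poch_self] using ModularForm.differentiableOn_tprod_one_sub_pow

lemma hasDiscSeries_poch_self : HasDiscSeries (fun q => poch q q) (eulerProd 1) := by
  have h := hasDiscSeries_of_differentiableOn differentiableOn_poch_self
  convert h
  ext n
  have h1 := hasProdLocallyUniformlyOn_iff_tendstoLocallyUniformlyOn.1
    ModularForm.multipliableLocallyUniformlyOn_one_sub_pow.hasProdLocallyUniformlyOn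
  have h2 : TendstoLocallyUniformlyOn (fun k (q : ℂ) => ∏ i ∈ range k, (1 - q ^ (i + 1)))
      (fun q => poch q q) atTop (ball 0 1) := by
    simp only [poch_self]
    intro u hu x hx
    obtain ⟨t, ht, h3⟩ := h1 u hu x hx
    exact ⟨t, ht, tendsto_finset_range.eventually h3⟩
  have h3 := ((tendstoLocallyUniformlyOn_iteratedDeriv isOpen_ball h2 (fun k => by fun_prop)
    n).tendsto_at (mem_ball_self one_pos)).div_const (n.factorial : ℂ)
  rw [coeff_mk]
  refine tendsto_nhds_unique (tendsto_const_nhds.congr' ?_) h3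
  filter_upwards [eventually_ge_atTop n] with k hk
  rw [← (hasDiscSeries_finset_prod k).coeff_eq]
  exact modX_eq_iff_coeff.1 (modX_eulerProd 1 (show n + 1 ≤ k + 1 by omega)) n n.lt_succ_self

lemma poch_self_ne_zero {q : ℂ} (hq : ‖q‖ < 1) : poch q q ≠ 0 := by
  rw [poch_self]
  simp only [sub_eq_add_neg]
  refine tprod_one_add_ne_zero_of_summable (fun i h => ?_) ?_
  · have h1 : q ^ (i + 1) = 1 := by linear_combination -h
    have h2 : ‖q ^ (i + 1)‖ < 1 := by
      rw [norm_pow]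
      exact pow_lt_one₀ (norm_nonneg _) hq (by omega)
    simp [h1] at h2
  · simpa using (summable_nat_add_iff 1).2 (summable_geometric_of_lt_one (norm_nonneg _) hq)

lemma hasDiscSeries_MwDiffSeries :
    HasDiscSeries (fun q => 4 * (poch (q ^ 5) (q ^ 5)) ^ 4 / poch q q) (MwDiffSeries ℂ) := by
  have h5 := hasDiscSeries_poch_self.comp_pow_five
  have hd : DifferentiableOn ℂ (fun q => 4 * (poch (q ^ 5) (q ^ 5)) ^ 4 / poch q q)
      (ball 0 1) := by
    refine DifferentiableOn.div ?_ differentiableOn_poch_self fun q hq =>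
      poch_self_ne_zero (by simpa using hq)
    refine ((differentiableOn_poch_self.comp (f := fun q : ℂ => q ^ 5) (by fun_prop)
      fun q hq => ?_).pow 4).const_mul 4
    simp only [mem_ball_zero_iff, norm_pow] at hq ⊢
    exact pow_lt_one₀ (norm_nonneg _) hq (by norm_num)
  have h := hasDiscSeries_of_differentiableOn hd
  set B : ℂ⟦X⟧ := mk _
  have h1 : HasDiscSeries (fun q => 4 * (poch (q ^ 5) (q ^ 5)) ^ 4) (B * eulerProd 1) := by
    intro q hq
    simpa [div_mul_cancel₀ _ (poch_self_ne_zero hq)] using h.mul hasDiscSeries_poch_self q hq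
  have h2 := h1.unique ((hasDiscSeries_C 4).mul (h5.pow 4))
  rw [map_ofNat, ← MwDiffSeries_mul_eulerProd] at h2
  rwa [(isUnit_eulerProd (1 : ℂ⟦X⟧)).mul_right_cancel h2] at h

end DiscExpansion

end AuxiliaryResults

/-- Identity (4.7):
`∑_{n≥0} (Mω(1,5,5n+4) − Mω(4,5,5n+4)) qⁿ = 4 (q⁵;q⁵)_∞⁴ / (q;q)_∞`
for `|q| < 1`. -/
theorem statement_18 (q : ℂ) (hq : ‖q‖ < 1) :
    ∑' n : ℕ, ((Mw 1 5 (5 * n + 4) - Mw 4 5 (5 * n + 4) : ℤ) : ℂ) * q ^ n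
      = 4 * (poch (q ^ 5) (q ^ 5)) ^ 4 / poch q q := by
  simpa only [MwDiffSeries, PowerSeries.coeff_mk] using (hasDiscSeries_MwDiffSeries q hq).tsum_eq

end Beck
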